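/- Let A be a real m×n semi-monotone matrix (A† ≥ 0) with A ≥ 0 entrywise. Let A = B − C be a proper weak regular splitting and A = U − V be a proper regular splitting of A. If B† ≥ U† (entrywise), then ρ(B†C) ≤ ρ(U†V) < 1. -/

import Mathlib

open Matrix

/-- `G` is the Moore-Penrose inverse of `A` (the four Penrose equations). -/
def IsMoorePenrose {m n : ℕ} (A : Matrix (Fin m) (Fin n) ℝ)
    (G : Matrix (Fin n) (Fin m) ℝ) : Prop :=
  A * G * A = A ∧ G * A * G = G ∧ (A * G)ᵀ = A * G ∧ (G * A)ᵀ = G * A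

/-- `A = U - V` is a proper splitting: `range U = range A` and `null U = null A`. -/
def IsProperSplitting {m n : ℕ} (A U V : Matrix (Fin m) (Fin n) ℝ) : Prop :=
  A = U - V ∧
    LinearMap.range U.mulVecLin = LinearMap.range A.mulVecLin ∧
    LinearMap.ker U.mulVecLin = LinearMap.ker A.mulVecLin

/-- The spectral radius of a real square matrix: the maximum modulus of its
complex eigenvalues. -/
noncomputable def specRad {k : ℕ} (X : Matrix (Fin k) (Fin k) ℝ) : ℝ :=
  (spectralRadius ℂ (X.map Complex.ofReal)).toReal

attribute [local instance] Matrix.linftyOpNormedRing Matrix.linftyOpNormedAlgebra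

theorem Matrix.mul_eq_zero_of_ker_le {m n k : ℕ} {A B : Matrix (Fin m) (Fin n) ℝ}
    (h : LinearMap.ker A.mulVecLin ≤ LinearMap.ker B.mulVecLin)
    {M : Matrix (Fin n) (Fin k) ℝ} (hM : A * M = 0) : B * M = 0 := by
  refine Matrix.ext_of_mulVec_single fun j => ?_
  have hA : M *ᵥ Pi.single j 1 ∈ LinearMap.ker A.mulVecLin := by
    simp only [LinearMap.mem_ker, mulVecLin_apply, mulVec_mulVec, hM, zero_mulVec]
  have hB := h hA
  simpa only [LinearMap.mem_ker, mulVecLin_apply, mulVec_mulVec, zero_mulVec] using hB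

theorem IsMoorePenrose.mul_mul_eq_of_range_le {m n : ℕ} {A U : Matrix (Fin m) (Fin n) ℝ}
    {G : Matrix (Fin n) (Fin m) ℝ} (hA : IsMoorePenrose A G)
    (h : LinearMap.range U.mulVecLin ≤ LinearMap.range A.mulVecLin) : A * G * U = U := by
  refine Matrix.ext_of_mulVec_single fun j => ?_
  obtain ⟨w, hw⟩ := h ⟨Pi.single j 1, rfl⟩
  simp only [mulVecLin_apply] at hw
  rw [← mulVec_mulVec, ← hw, mulVec_mulVec, hA.1]

theorem IsMoorePenrose.mul_eq_mul_of_ker_eq {m n : ℕ} {A B : Matrix (Fin m) (Fin n) ℝ}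
    {Ad Bd : Matrix (Fin n) (Fin m) ℝ} (hA : IsMoorePenrose A Ad) (hB : IsMoorePenrose B Bd)
    (h : LinearMap.ker B.mulVecLin = LinearMap.ker A.mulVecLin) : Bd * B = Ad * A := by
  have hBA : B * (1 - Ad * A) = 0 := mul_eq_zero_of_ker_le h.ge (by
    rw [Matrix.mul_sub, ← Matrix.mul_assoc, hA.1, Matrix.mul_one, sub_self])
  have hAB : A * (1 - Bd * B) = 0 := mul_eq_zero_of_ker_le h.le (by
    rw [Matrix.mul_sub, ← Matrix.mul_assoc, hB.1, Matrix.mul_one, sub_self])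
  rw [Matrix.mul_sub, Matrix.mul_one, sub_eq_zero] at hBA hAB
  have h1 : Bd * B = (Bd * B) * (Ad * A) := by rw [Matrix.mul_assoc Bd B, ← hBA]
  have h2 : Ad * A = (Ad * A) * (Bd * B) := by rw [Matrix.mul_assoc Ad A, ← hAB]
  have h3 := congrArg transpose h2
  rw [transpose_mul (Ad * A), hA.2.2.2, hB.2.2.2] at h3
  rw [h1, ← h3]

theorem IsMoorePenrose.mul_mul_eq_of_range_eq {m n : ℕ} {A U : Matrix (Fin m) (Fin n) ℝ}
    {Ad Ud : Matrix (Fin n) (Fin m) ℝ} (hA : IsMoorePenrose A Ad) (hU : IsMoorePenrose U Ud)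
    (h : LinearMap.range U.mulVecLin ≤ LinearMap.range A.mulVecLin) : Ud * (A * Ad) = Ud := by
  have h1 : (A * Ad) * (U * Ud) = U * Ud := by
    rw [← Matrix.mul_assoc, hA.mul_mul_eq_of_range_le h]
  have h2 := congrArg transpose h1
  rw [transpose_mul, hA.2.2.1, hU.2.2.1] at h2
  calc Ud * (A * Ad) = Ud * ((U * Ud) * (A * Ad)) := by
        conv_lhs => rw [← hU.2.1]
        simp only [Matrix.mul_assoc]
    _ = Ud := by rw [h2, ← Matrix.mul_assoc, hU.2.1]

theorem IsProperSplitting.mul_eq_sub {m n : ℕ} {A U V : Matrix (Fin m) (Fin n) ℝ}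
    {Ad Ud : Matrix (Fin n) (Fin m) ℝ} (h : IsProperSplitting A U V)
    (hA : IsMoorePenrose A Ad) (hU : IsMoorePenrose U Ud) : Ud * V = Ad * A - Ud * A := by
  rw [← hA.mul_eq_mul_of_ker_eq hU h.2.2, ← Matrix.mul_sub, h.1, sub_sub_cancel]

theorem IsProperSplitting.mul_mul_eq_sub {m n : ℕ} {A U V : Matrix (Fin m) (Fin n) ℝ}
    {Ad Ud : Matrix (Fin n) (Fin m) ℝ} (h : IsProperSplitting A U V)
    (hA : IsMoorePenrose A Ad) (hU : IsMoorePenrose U Ud) : Ud * V * Ad = Ad - Ud := by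
  rw [h.mul_eq_sub hA hU, Matrix.sub_mul, hA.2.1, Matrix.mul_assoc Ud,
    hA.mul_mul_eq_of_range_eq hU h.2.1.le]

theorem Matrix.mul_apply_nonneg {l m n : Type*} [Fintype m] {M : Matrix l m ℝ}
    {N : Matrix m n ℝ} (hM : ∀ i j, 0 ≤ M i j) (hN : ∀ i j, 0 ≤ N i j) (i : l) (j : n) :
    0 ≤ (M * N) i j := by
  rw [mul_apply]
  exact Finset.sum_nonneg fun k _ => mul_nonneg (hM i k) (hN k j)

theorem Matrix.pow_apply_mono {k : ℕ} {Y X : Matrix (Fin k) (Fin k) ℝ} (hY : ∀ i j, 0 ≤ Y i j)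
    (h : ∀ i j, Y i j ≤ X i j) (N : ℕ) (i j : Fin k) : (Y ^ N) i j ≤ (X ^ N) i j := by
  induction N generalizing i j with
  | zero => simp
  | succ N ih =>
    rw [pow_succ, pow_succ, mul_apply, mul_apply]
    exact Finset.sum_le_sum fun l _ => mul_le_mul (ih i l) (h l j) (hY l j)
      ((pow_apply_nonneg hY N i l).trans (ih i l))

theorem Matrix.map_ofReal_pow {k : ℕ} (X : Matrix (Fin k) (Fin k) ℝ) (N : ℕ) :
    X.map Complex.ofReal ^ N = (X ^ N).map Complex.ofReal :=
  (map_pow (Complex.ofRealHom.mapMatrix (m := Fin k)) X N).symm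

theorem Matrix.linfty_opNNNorm_map_ofReal_mono {k : ℕ} {Y X : Matrix (Fin k) (Fin k) ℝ}
    (hY : ∀ i j, 0 ≤ Y i j) (h : ∀ i j, Y i j ≤ X i j) :
    ‖Y.map Complex.ofReal‖₊ ≤ ‖X.map Complex.ofReal‖₊ := by
  rw [linfty_opNNNorm_def, linfty_opNNNorm_def]
  refine Finset.sup_mono_fun fun i _ => Finset.sum_le_sum fun j _ => ?_
  rw [← NNReal.coe_le_coe]
  simpa [abs_of_nonneg (hY i j), abs_of_nonneg ((hY i j).trans (h i j))] using h i j

theorem Matrix.spectralRadius_map_ofReal_mono {k : ℕ} {Y X : Matrix (Fin k) (Fin k) ℝ}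
    (hY : ∀ i j, 0 ≤ Y i j) (h : ∀ i j, Y i j ≤ X i j) :
    spectralRadius ℂ (Y.map Complex.ofReal) ≤ spectralRadius ℂ (X.map Complex.ofReal) := by
  refine le_of_tendsto_of_tendsto'
    (spectrum.pow_nnnorm_pow_one_div_tendsto_nhds_spectralRadius (Y.map Complex.ofReal))
    (spectrum.pow_nnnorm_pow_one_div_tendsto_nhds_spectralRadius (X.map Complex.ofReal))
    fun N => ENNReal.rpow_le_rpow ?_ (by positivity)
  rw [map_ofReal_pow, map_ofReal_pow]
  exact ENNReal.coe_le_coe.2 (linfty_opNNNorm_map_ofReal_mono (pow_apply_nonneg hY N)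
    (pow_apply_mono hY h N))

open Filter Topology in
theorem Matrix.spectralRadius_map_ofReal_lt_one {k : ℕ} {X : Matrix (Fin k) (Fin k) ℝ}
    (h : ∀ i j, Tendsto (fun N : ℕ => (X ^ N) i j) atTop (𝓝 0)) :
    spectralRadius ℂ (X.map Complex.ofReal) < 1 := by
  have hlim : Tendsto (fun N : ℕ => X.map Complex.ofReal ^ N) atTop (𝓝 0) := by
    refine tendsto_pi_nhds.2 fun i => tendsto_pi_nhds.2 fun j => ?_
    have := (Complex.continuous_ofReal.tendsto 0).comp (h i j)
    simpa [map_ofReal_pow, Function.comp_def] using this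
  have hmul : Tendsto (fun N : ℕ => ‖X.map Complex.ofReal ^ (N + 1)‖₊ *
      ‖(1 : Matrix (Fin k) (Fin k) ℂ)‖₊) atTop (𝓝 0) := by
    simpa using (hlim.comp (tendsto_add_atTop_nat 1)).nnnorm.mul_const
      ‖(1 : Matrix (Fin k) (Fin k) ℂ)‖₊
  obtain ⟨N, hN⟩ := (hmul.eventually_lt_const zero_lt_one).exists
  refine (spectrum.spectralRadius_le_pow_nnnorm_pow_one_div ℂ (X.map Complex.ofReal) N).trans_lt ?_
  rw [← ENNReal.mul_rpow_of_nonneg _ _ (by positivity)]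
  exact ENNReal.rpow_lt_one (by exact_mod_cast hN) (by positivity)

theorem IsProperSplitting.sum_pow_mul_add {m n : ℕ} {A U V : Matrix (Fin m) (Fin n) ℝ}
    {Ad Ud : Matrix (Fin n) (Fin m) ℝ} (h : IsProperSplitting A U V)
    (hA : IsMoorePenrose A Ad) (hU : IsMoorePenrose U Ud) (N : ℕ) :
    (∑ k ∈ Finset.range N, (Ud * V) ^ k) * Ud + (Ud * V) ^ N * Ad = Ad := by
  induction N with
  | zero => simp
  | succ N ih =>
    rw [Finset.sum_range_succ, Matrix.add_mul, pow_succ (Ud * V) N, Matrix.mul_assoc _ (Ud * V) Ad,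
      h.mul_mul_eq_sub hA hU, Matrix.mul_sub, add_assoc, add_sub_cancel, ih]

open Filter Topology in
theorem IsProperSplitting.tendsto_pow_apply {m n : ℕ} {A U V : Matrix (Fin m) (Fin n) ℝ}
    {Ad Ud : Matrix (Fin n) (Fin m) ℝ} (h : IsProperSplitting A U V)
    (hA : IsMoorePenrose A Ad) (hU : IsMoorePenrose U Ud) (hAd : ∀ i j, 0 ≤ Ad i j)
    (hUd : ∀ i j, 0 ≤ Ud i j) (hV : ∀ i j, 0 ≤ V i j) (i j : Fin n) :
    Tendsto (fun N : ℕ => ((Ud * V) ^ N) i j) atTop (𝓝 0) := by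
  have hX := mul_apply_nonneg hUd hV
  refine (tendsto_add_atTop_iff_nat 1).1 (Summable.tendsto_atTop_zero ?_)
  refine summable_of_sum_range_le (c := (Ad * V) i j)
    (fun N => pow_apply_nonneg hX (N + 1) i j) fun N => ?_
  have hsum : ∑ k ∈ Finset.range N, (Ud * V) ^ (k + 1) + (Ud * V) ^ N * (Ad * V) = Ad * V := by
    conv_rhs => rw [← h.sum_pow_mul_add hA hU N]
    rw [Matrix.add_mul, Matrix.mul_assoc _ Ud V, Finset.sum_mul, Matrix.mul_assoc _ Ad V]
    simp only [pow_succ]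
  have hij := congrFun (congrFun hsum i) j
  rw [Matrix.add_apply, Matrix.sum_apply] at hij
  have := mul_apply_nonneg (pow_apply_nonneg hX N) (mul_apply_nonneg hAd hV) i j
  linarith

theorem stmt11 {m n : ℕ} (A B C U V : Matrix (Fin m) (Fin n) ℝ)
    (Ad Bd Ud : Matrix (Fin n) (Fin m) ℝ)
    (hA : IsMoorePenrose A Ad) (hB : IsMoorePenrose B Bd) (hU : IsMoorePenrose U Ud)
    (hsemi : ∀ i j, 0 ≤ Ad i j) (hApos : ∀ i j, 0 ≤ A i j)
    -- A = B - C is a proper weak regular splitting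
    (hPSB : IsProperSplitting A B C)
    (hBd : ∀ i j, 0 ≤ Bd i j) (hBC : ∀ i j, 0 ≤ (Bd * C) i j)
    -- A = U - V is a proper regular splitting
    (hPSU : IsProperSplitting A U V)
    (hUd : ∀ i j, 0 ≤ Ud i j) (hV : ∀ i j, 0 ≤ V i j)
    (hcomp : ∀ i j, Ud i j ≤ Bd i j) :
    specRad (Bd * C) ≤ specRad (Ud * V) ∧ specRad (Ud * V) < 1 := by
  have hlt := spectralRadius_map_ofReal_lt_one (hPSU.tendsto_pow_apply hA hU hsemi hUd hV)
  refine ⟨ENNReal.toReal_mono hlt.ne_top (spectralRadius_map_ofReal_mono hBC fun i j => ?_), ?_⟩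
  · rw [hPSB.mul_eq_sub hA hB, hPSU.mul_eq_sub hA hU, Matrix.sub_apply, Matrix.sub_apply]
    refine sub_le_sub_left ?_ _
    rw [mul_apply, mul_apply]
    exact Finset.sum_le_sum fun l _ => mul_le_mul_of_nonneg_right (hcomp i l) (hApos l j)
  · exact (ENNReal.toReal_lt_of_lt_ofReal (by simpa using hlt))
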